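/- (Weighted Young's inequality) For $x\in\mathbb R^n$ put $\langle x\rangle := (1+|x|^2)^{1/2}$. For $1\le p<\infty$ and $a\ge 0$ let $\|f\|_{L^p_{\langle x\rangle^a}} := \left(\int_{\mathbb R^n}|f(x)|^p\langle x\rangle^a\,dx\right)^{1/p}$, and let $\|f\|_{L^\infty_{\langle x\rangle^a}} := \operatorname{ess\,sup}_{x\in\mathbb R^n}|f(x)|$. Let $n\ge 1$, $a\ge 0$, and let $1\le p,q,r\le\infty$ satisfy $1/r+1=1/p+1/q$ (with $1/\infty=0$). Then for all measurable $f,g:\mathbb R^n\to\mathbb C$, $$\big\|\,|f|*|g|\,\big\|_{L^r_{\langle x\rangle^a}}\le (4/3)^{\frac{a}{2r}}\,\|f\|_{L^p_{\langle x\rangle^a}}\|g\|_{L^q_{\langle x\rangle^a}},$$ where $(|f|*|g|)(x):=\int_{\mathbb R^n}|f(y)||g(x-y)|\,dy$, both sides may be $+\infty$, and $0\cdot\infty=0$. Moreover, if both norms on the right are finite, then $(f*g)(x):=\int_{\mathbb R^n}f(y)g(x-y)\,dy$ converges absolutely for almost every $x$, and $\|f*g\|_{L^r_{\langle x\rangle^a}}\le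 (4/3)^{\frac{a}{2r}}\|f\|_{L^p_{\langle x\rangle^a}}\|g\|_{L^q_{\langle x\rangle^a}}$. -/

import Mathlib

open MeasureTheory
open scoped ENNReal

noncomputable section

abbrev Eu (n : ℕ) := EuclideanSpace ℝ (Fin n)

/-- The polynomial weight `⟨x⟩^a = (1+|x|²)^{a/2}` as an `ℝ≥0∞`-valued function. -/
def jweight {n : ℕ} (a : ℝ) (x : Eu n) : ℝ≥0∞ :=
  ENNReal.ofReal ((1 + ‖x‖ ^ 2) ^ (a / 2))

/-- Weighted Lebesgue norm of a nonnegative function that may take the value `∞`;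
for `p = ∞` it is the (unweighted) essential supremum. -/
def wNormE {n : ℕ} (p : ℝ≥0∞) (a : ℝ) (f : Eu n → ℝ≥0∞) : ℝ≥0∞ :=
  if p = ∞ then essSup f volume
  else (∫⁻ x, f x ^ p.toReal * jweight a x) ^ (1 / p.toReal)

/-- Weighted Lebesgue norm `‖f‖_{L^p_{⟨x⟩^a}}` of a complex-valued function. -/
def wNorm {n : ℕ} (p : ℝ≥0∞) (a : ℝ) (f : Eu n → ℂ) : ℝ≥0∞ :=
  wNormE p a (fun x => ‖f x‖ₑ)

/-- The convolution `(|f| ∗ |g|)(x) = ∫ |f(y)| |g(x-y)| dy`, with values in `[0,∞]`. -/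
def absConv {n : ℕ} (f g : Eu n → ℂ) (x : Eu n) : ℝ≥0∞ :=
  ∫⁻ y, ‖f y‖ₑ * ‖g (x - y)‖ₑ

/-- The constant `(4/3)^{a/(2r)}`, equal to `1` for `r = ∞`. -/
def youngConst (a : ℝ) (r : ℝ≥0∞) : ℝ≥0∞ :=
  ENNReal.ofReal ((4 / 3 : ℝ) ^ (a / 2 * (1 / r).toReal))

end

section Young

variable {n : ℕ}

theorem aemeasurable_comp_sub_left {G : Eu n → ℝ≥0∞} (hG : AEMeasurable G volume) (x : Eu n) :
    AEMeasurable (fun y => G (x - y)) volume :=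
  hG.comp_quasiMeasurePreserving (Measure.measurePreserving_sub_left volume x).quasiMeasurePreserving

theorem lintegral_lintegral_mul_comp_sub {F G : Eu n → ℝ≥0∞} (hF : AEMeasurable F volume)
    (hG : AEMeasurable G volume) :
    ∫⁻ x, ∫⁻ y, F y * G (x - y) = (∫⁻ y, F y) * ∫⁻ y, G y := by
  have hsub : AEMeasurable (fun z : Eu n × Eu n => G (z.1 - z.2)) (volume.prod volume) :=
    hG.comp_quasiMeasurePreserving
      (quasiMeasurePreserving_sub_of_right_invariant (volume : Measure (Eu n)) volume)
  rw [lintegral_lintegral_swap (hF.comp_snd.mul hsub), ← lintegral_mul_const'' _ hF]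
  refine lintegral_congr fun y => ?_
  have hGy : AEMeasurable (fun x => G (x - y)) volume := hG.comp_quasiMeasurePreserving
    (measurePreserving_sub_right volume y).quasiMeasurePreserving
  rw [lintegral_const_mul'' _ hGy, lintegral_sub_right_eq_self G y]

/-- **Young's convolution inequality** for `[0,∞]`-valued functions and finite exponents. -/
theorem lintegral_rpow_conv_le {P Q R : ℝ} (hP : 1 ≤ P) (hQ : 1 ≤ Q) (hR : 1 ≤ R)
    (h : 1 / R + 1 = 1 / P + 1 / Q) {F G : Eu n → ℝ≥0∞} (hF : AEMeasurable F volume)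
    (hG : AEMeasurable G volume) :
    (∫⁻ x, (∫⁻ y, F y * G (x - y)) ^ R) ^ (1 / R) ≤
      (∫⁻ y, F y ^ P) ^ (1 / P) * (∫⁻ y, G y ^ Q) ^ (1 / Q) := by
  have hP0 : 0 < P := by linarith
  have hQ0 : 0 < Q := by linarith
  have hR0 : 0 < R := by linarith
  have hP1 : 1 / P ≤ 1 := by rw [div_le_one hP0]; exact hP
  have hQ1 : 1 / Q ≤ 1 := by rw [div_le_one hQ0]; exact hQ
  have hR1 : 0 ≤ 1 / R := by positivity
  have hPR : 0 ≤ 1 / P - 1 / R := by linarith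
  have hQR : 0 ≤ 1 / Q - 1 / R := by linarith
  set A := ∫⁻ y, F y ^ P
  set B := ∫⁻ y, G y ^ Q
  have split : ∀ {S : ℝ}, 0 < S → 0 ≤ 1 / S - 1 / R → ∀ u : ℝ≥0∞,
      (u ^ S) ^ (1 / R) * (u ^ S) ^ (1 / S - 1 / R) = u := by
    intro S hS hSR u
    rw [← ENNReal.rpow_add_of_nonneg _ _ hR1 hSR, ← ENNReal.rpow_mul]
    have : S * (1 / R + (1 / S - 1 / R)) = 1 := by field_simp; ring
    rw [this, ENNReal.rpow_one]
  have pointwise : ∀ x, ∫⁻ y, F y * G (x - y) ≤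
      (∫⁻ y, F y ^ P * G (x - y) ^ Q) ^ (1 / R) * (A ^ (1 / P - 1 / R) * B ^ (1 / Q - 1 / R)) := by
    intro x
    have hGx := aemeasurable_comp_sub_left hG x
    have holder := ENNReal.lintegral_prod_norm_pow_le (μ := (volume : Measure (Eu n)))
      (Finset.univ : Finset (Fin 3))
      (f := ![fun y => F y ^ P * G (x - y) ^ Q, fun y => F y ^ P, fun y => G (x - y) ^ Q])
      (p := ![1 / R, 1 / P - 1 / R, 1 / Q - 1 / R])
      (by
        intro i _
        fin_cases i
        · exact (hF.pow_const P).mul (hGx.pow_const Q)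
        · exact hF.pow_const P
        · exact hGx.pow_const Q)
      (by simp only [Fin.sum_univ_three, Matrix.cons_val]; linarith)
      (by
        intro i _
        fin_cases i
        · exact hR1
        · exact hPR
        · exact hQR)
    simp only [Fin.prod_univ_three, Matrix.cons_val] at holder
    rw [lintegral_sub_left_eq_self (fun y => G y ^ Q) x, mul_assoc] at holder
    refine le_trans (le_of_eq (lintegral_congr fun y => ?_)) holder
    rw [ENNReal.mul_rpow_of_nonneg _ _ hR1]
    conv_lhs => rw [← split hP0 hPR (F y), ← split hQ0 hQR (G (x - y))]
    ring
  have hRR : 1 / R * R = 1 := by field_simp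
  calc (∫⁻ x, (∫⁻ y, F y * G (x - y)) ^ R) ^ (1 / R)
      ≤ (∫⁻ x, (∫⁻ y, F y ^ P * G (x - y) ^ Q) *
          (A ^ (1 / P - 1 / R) * B ^ (1 / Q - 1 / R)) ^ R) ^ (1 / R) := by
        gcongr with x
        refine (ENNReal.rpow_le_rpow (pointwise x) hR0.le).trans_eq ?_
        rw [ENNReal.mul_rpow_of_nonneg _ _ hR0.le, ← ENNReal.rpow_mul, hRR, ENNReal.rpow_one]
    _ = (A * B * (A ^ (1 / P - 1 / R) * B ^ (1 / Q - 1 / R)) ^ R) ^ (1 / R) := by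
        have hsub : AEMeasurable (fun z : Eu n × Eu n => F z.2 ^ P * G (z.1 - z.2) ^ Q)
            (volume.prod volume) :=
          (hF.pow_const P).comp_snd.mul ((hG.pow_const Q).comp_quasiMeasurePreserving
            (quasiMeasurePreserving_sub_of_right_invariant (volume : Measure (Eu n)) volume))
        rw [lintegral_mul_const'' _ hsub.lintegral_prod_right',
          lintegral_lintegral_mul_comp_sub (hF.pow_const P) (hG.pow_const Q)]
    _ = A ^ (1 / P) * B ^ (1 / Q) := by
        rw [ENNReal.mul_rpow_of_nonneg _ _ hR1, ENNReal.mul_rpow_of_nonneg _ _ hR1,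
          ← ENNReal.rpow_mul, mul_comm R, hRR, ENNReal.rpow_one, mul_mul_mul_comm,
          ← ENNReal.rpow_add_of_nonneg _ _ hR1 hPR, ← ENNReal.rpow_add_of_nonneg _ _ hR1 hQR,
          add_sub_cancel, add_sub_cancel]

end Young

section Weight

variable {n : ℕ} {a : ℝ}

theorem measurable_jweight : Measurable (jweight a : Eu n → ℝ≥0∞) := by
  unfold jweight
  fun_prop

theorem jweight_ne_top (x : Eu n) : jweight a x ≠ ∞ := ENNReal.ofReal_ne_top

theorem one_le_jweight (ha : 0 ≤ a) (x : Eu n) : 1 ≤ jweight a x := by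
  rw [jweight, ENNReal.one_le_ofReal]
  exact Real.one_le_rpow (by nlinarith [sq_nonneg ‖x‖]) (by positivity)

theorem one_add_norm_sq_le (x y : Eu n) :
    1 + ‖x‖ ^ 2 ≤ 4 / 3 * ((1 + ‖y‖ ^ 2) * (1 + ‖x - y‖ ^ 2)) := by
  have htri : ‖x‖ ≤ ‖y‖ + ‖x - y‖ := by simpa using norm_add_le y (x - y)
  have hsq : ‖x‖ ^ 2 ≤ (‖y‖ + ‖x - y‖) ^ 2 := by gcongr
  linarith [sq_nonneg (‖y‖ - ‖x - y‖), sq_nonneg (1 - 2 * (‖y‖ * ‖x - y‖))]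

/-- Submultiplicativity of the weight, up to the optimal constant. -/
theorem jweight_le (ha : 0 ≤ a) (x y : Eu n) :
    jweight a x ≤
      ENNReal.ofReal ((4 / 3 : ℝ) ^ (a / 2)) * (jweight a y * jweight a (x - y)) := by
  unfold jweight
  rw [← ENNReal.ofReal_mul (by positivity), ← ENNReal.ofReal_mul (by positivity),
    ← Real.mul_rpow (by positivity) (by positivity), ← Real.mul_rpow (by norm_num) (by positivity)]
  exact ENNReal.ofReal_le_ofReal
    (Real.rpow_le_rpow (by positivity) (one_add_norm_sq_le x y) (by positivity))

theorem lintegral_rpow_le_wNormE (ha : 0 ≤ a) {p : ℝ≥0∞} (hp : p ≠ ∞) (f : Eu n → ℝ≥0∞) :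
    (∫⁻ x, f x ^ p.toReal) ^ (1 / p.toReal) ≤ wNormE p a f := by
  rw [wNormE, if_neg hp]
  gcongr with x
  exact le_mul_of_one_le_right' (one_le_jweight ha x)

theorem lintegral_mul_jweight_rpow_le_wNormE (ha : 0 ≤ a) {p : ℝ≥0∞} (hp : p ≠ ∞) {R : ℝ}
    (hR : 0 < R) (hpR : p.toReal ≤ R) (f : Eu n → ℝ≥0∞) :
    (∫⁻ x, (f x * jweight a x ^ (1 / R)) ^ p.toReal) ^ (1 / p.toReal) ≤ wNormE p a f := by
  rw [wNormE, if_neg hp]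
  gcongr with x
  rw [ENNReal.mul_rpow_of_nonneg _ _ ENNReal.toReal_nonneg, ← ENNReal.rpow_mul]
  gcongr
  calc jweight a x ^ (1 / R * p.toReal) ≤ jweight a x ^ (1 : ℝ) := by
        apply ENNReal.rpow_le_rpow_of_exponent_le (one_le_jweight ha x)
        rw [one_div_mul_eq_div, div_le_one hR]
        exact hpR
    _ = jweight a x := ENNReal.rpow_one _

theorem wNormE_mono {p : ℝ≥0∞} {f g : Eu n → ℝ≥0∞} (h : ∀ x, f x ≤ g x) :
    wNormE p a f ≤ wNormE p a g := by
  unfold wNormE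
  split_ifs
  · exact essSup_mono_ae (Filter.Eventually.of_forall h)
  · gcongr with x
    exact h x

theorem ae_lt_top_of_wNormE_lt_top (ha : 0 ≤ a) {p : ℝ≥0∞} (hp : 1 ≤ p) {f : Eu n → ℝ≥0∞}
    (hf : AEMeasurable f volume) (h : wNormE p a f < ∞) : ∀ᵐ x, f x < ∞ := by
  by_cases hp' : p = ∞
  · rw [wNormE, if_pos hp'] at h
    filter_upwards [ENNReal.ae_le_essSup f] with x hx using hx.trans_lt h
  · have hp0 : 0 < p.toReal := ENNReal.toReal_pos (zero_lt_one.trans_le hp).ne' hp'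
    have h' := (lintegral_rpow_le_wNormE ha hp' f).trans_lt h
    rw [ENNReal.rpow_lt_top_iff_of_pos (by positivity)] at h'
    filter_upwards [ae_lt_top' (hf.pow_const _) h'.ne] with x hx
    exact (ENNReal.rpow_lt_top_iff_of_pos hp0).1 hx

end Weight

section Convolution

variable {n : ℕ} {a : ℝ} {p q r : ℝ≥0∞} {f g : Eu n → ℂ}

theorem aemeasurable_absConv (hf : AEMeasurable f volume) (hg : AEMeasurable g volume) :
    AEMeasurable (absConv f g) volume := by
  have hsub : AEMeasurable (fun z : Eu n × Eu n => ‖f z.2‖ₑ * ‖g (z.1 - z.2)‖ₑ)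
      (volume.prod volume) :=
    hf.enorm.comp_snd.mul (hg.enorm.comp_quasiMeasurePreserving
      (quasiMeasurePreserving_sub_of_right_invariant (volume : Measure (Eu n)) volume))
  exact hsub.lintegral_prod_right'

theorem convolutionExistsAt_mul_of_absConv_lt_top (hf : AEMeasurable f volume)
    (hg : AEMeasurable g volume) {x : Eu n} (h : absConv f g x < ∞) :
    ConvolutionExistsAt f g x (ContinuousLinearMap.mul ℂ ℂ) volume := by
  refine ⟨hf.aestronglyMeasurable.convolution_integrand_snd _ hg.aestronglyMeasurable x, ?_⟩
  simpa only [HasFiniteIntegral, ContinuousLinearMap.mul_apply', enorm_mul, absConv] using h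

theorem enorm_convolution_mul_le_absConv (x : Eu n) :
    ‖convolution f g (ContinuousLinearMap.mul ℂ ℂ) volume x‖ₑ ≤ absConv f g x := by
  refine (enorm_integral_le_lintegral_enorm _).trans_eq ?_
  simp only [ContinuousLinearMap.mul_apply', enorm_mul, absConv]

theorem youngConst_top : youngConst a ∞ = 1 := by simp [youngConst]

theorem youngConst_eq_rpow :
    youngConst a r = ENNReal.ofReal ((4 / 3 : ℝ) ^ (a / 2)) ^ (1 / r.toReal) := by
  rw [youngConst, Real.rpow_mul (by norm_num), ENNReal.ofReal_rpow_of_nonneg (by positivity)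
    (by positivity)]
  simp

theorem absConv_comm (f g : Eu n → ℂ) : absConv f g = absConv g f := by
  ext x
  rw [absConv, ← lintegral_sub_left_eq_self _ x]
  simp [absConv, mul_comm]

theorem absConv_le_essSup_mul (ha : 0 ≤ a) (hg : AEMeasurable g volume) (x : Eu n) :
    absConv f g x ≤ wNorm ∞ a f * wNorm 1 a g := by
  have hgx := aemeasurable_comp_sub_left hg.enorm x
  calc absConv f g x ≤ ∫⁻ y, wNorm ∞ a f * ‖g (x - y)‖ₑ := by
        refine lintegral_mono_ae ?_
        filter_upwards [ENNReal.ae_le_essSup (μ := volume) fun y => ‖f y‖ₑ] with y hy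
        rw [wNorm, wNormE, if_pos rfl]
        gcongr
    _ = wNorm ∞ a f * ∫⁻ y, ‖g y‖ₑ := by
        rw [lintegral_const_mul'' _ hgx, lintegral_sub_left_eq_self (fun y => ‖g y‖ₑ) x]
    _ ≤ wNorm ∞ a f * wNorm 1 a g := by
        gcongr
        simpa [wNorm] using lintegral_rpow_le_wNormE ha ENNReal.one_ne_top fun y => ‖g y‖ₑ

theorem absConv_le_of_conjugate (ha : 0 ≤ a) (hp : 1 ≤ p) (hq : 1 ≤ q) (hpq : 1 = 1 / p + 1 / q)
    (hf : AEMeasurable f volume) (hg : AEMeasurable g volume) (x : Eu n) :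
    absConv f g x ≤ wNorm p a f * wNorm q a g := by
  rcases eq_or_ne p ∞ with rfl | hp'
  · obtain rfl : q = 1 := by simpa [eq_comm] using hpq
    exact absConv_le_essSup_mul ha hg x
  rcases eq_or_ne q ∞ with rfl | hq'
  · obtain rfl : p = 1 := by simpa [eq_comm] using hpq
    rw [absConv_comm, mul_comm]
    exact absConv_le_essSup_mul ha hf x
  have hp0 : 0 < p.toReal := ENNReal.toReal_pos (zero_lt_one.trans_le hp).ne' hp'
  have hq0 : 0 < q.toReal := ENNReal.toReal_pos (zero_lt_one.trans_le hq).ne' hq'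
  have hpq' : 1 / p.toReal + 1 / q.toReal = 1 := by
    have := congrArg ENNReal.toReal hpq
    rw [ENNReal.toReal_add (by simp; exact (zero_lt_one.trans_le hp).ne')
      (by simp; exact (zero_lt_one.trans_le hq).ne')] at this
    simpa using this.symm
  have holder := ENNReal.lintegral_mul_norm_pow_le (hf.enorm.pow_const p.toReal)
    ((aemeasurable_comp_sub_left hg.enorm x).pow_const q.toReal)
    (one_div_nonneg.2 hp0.le) (one_div_nonneg.2 hq0.le) hpq'
  rw [lintegral_sub_left_eq_self (fun y => ‖g y‖ₑ ^ q.toReal) x] at holder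
  simp only [← ENNReal.rpow_mul, mul_one_div_cancel hp0.ne', mul_one_div_cancel hq0.ne',
    ENNReal.rpow_one] at holder
  exact holder.trans (mul_le_mul' (lintegral_rpow_le_wNormE ha hp' _)
    (lintegral_rpow_le_wNormE ha hq' _))

theorem absConv_mul_jweight_rpow_le (ha : 0 ≤ a) {R : ℝ} (hR : 0 < R) (x : Eu n) :
    absConv f g x * jweight a x ^ (1 / R) ≤
      ENNReal.ofReal ((4 / 3 : ℝ) ^ (a / 2)) ^ (1 / R) *
        ∫⁻ y, (‖f y‖ₑ * jweight a y ^ (1 / R)) *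
          (‖g (x - y)‖ₑ * jweight a (x - y) ^ (1 / R)) := by
  have hR' : 0 ≤ 1 / R := by positivity
  rw [absConv, ← lintegral_mul_const' _ _ (ENNReal.rpow_ne_top_of_nonneg hR' (jweight_ne_top x)),
    ← lintegral_const_mul' _ _ (ENNReal.rpow_ne_top_of_nonneg hR' ENNReal.ofReal_ne_top)]
  refine lintegral_mono fun y => ?_
  calc ‖f y‖ₑ * ‖g (x - y)‖ₑ * jweight a x ^ (1 / R)
      ≤ ‖f y‖ₑ * ‖g (x - y)‖ₑ * (ENNReal.ofReal ((4 / 3 : ℝ) ^ (a / 2)) *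
          (jweight a y * jweight a (x - y))) ^ (1 / R) := by
        gcongr
        exact jweight_le ha x y
    _ = _ := by
        rw [ENNReal.mul_rpow_of_nonneg _ _ hR', ENNReal.mul_rpow_of_nonneg _ _ hR']
        ring

theorem wNormE_absConv_le_of_ne_top (ha : 0 ≤ a) (hp : 1 ≤ p) (hq : 1 ≤ q) (hr : 1 ≤ r)
    (hr' : r ≠ ∞) (hpqr : 1 / r + 1 = 1 / p + 1 / q)
    (hf : AEMeasurable f volume) (hg : AEMeasurable g volume) :
    wNormE r a (absConv f g) ≤ youngConst a r * (wNorm p a f * wNorm q a g) := by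
  have le_of_conj : ∀ {s t : ℝ≥0∞}, 1 ≤ t → 1 / r + 1 = 1 / s + 1 / t → s ≤ r := by
    intro s t ht hst
    have h1 : 1 / r + 1 ≤ 1 / s + 1 := by
      rw [hst]
      gcongr
      simpa using ht
    simpa using (ENNReal.add_le_add_iff_right ENNReal.one_ne_top).1 h1
  have hpr : p ≤ r := le_of_conj hq hpqr
  have hqr : q ≤ r := le_of_conj hp (by rw [hpqr, add_comm])
  have hp' : p ≠ ∞ := ne_top_of_le_ne_top hr' hpr
  have hq' : q ≠ ∞ := ne_top_of_le_ne_top hr' hqr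
  have one_le : ∀ {s : ℝ≥0∞}, 1 ≤ s → s ≠ ∞ → 1 ≤ s.toReal := fun hs hs' => by
    simpa using ENNReal.toReal_mono hs' hs
  have hR := one_le hr hr'
  have hR0 : 0 < r.toReal := by linarith
  have hR1 : 0 ≤ 1 / r.toReal := by positivity
  have hpqr' : 1 / r.toReal + 1 = 1 / p.toReal + 1 / q.toReal := by
    have hinv : ∀ {s : ℝ≥0∞}, 1 ≤ s → 1 / s ≠ ∞ := fun hs => by
      simpa using (zero_lt_one.trans_le hs).ne'
    have := congrArg ENNReal.toReal hpqr
    rw [ENNReal.toReal_add (hinv hr) ENNReal.one_ne_top,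
      ENNReal.toReal_add (hinv hp) (hinv hq)] at this
    simpa using this
  have hweight : AEMeasurable (fun x : Eu n => jweight a x ^ (1 / r.toReal)) volume :=
    (measurable_jweight.pow_const _).aemeasurable
  set K := ENNReal.ofReal ((4 / 3 : ℝ) ^ (a / 2))
  set F : Eu n → ℝ≥0∞ := fun y => ‖f y‖ₑ * jweight a y ^ (1 / r.toReal)
  set G : Eu n → ℝ≥0∞ := fun y => ‖g y‖ₑ * jweight a y ^ (1 / r.toReal)
  calc wNormE r a (absConv f g)
      = (∫⁻ x, (absConv f g x * jweight a x ^ (1 / r.toReal)) ^ r.toReal) ^ (1 / r.toReal) := by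
        rw [wNormE, if_neg hr']
        congr 1
        refine lintegral_congr fun x => ?_
        rw [ENNReal.mul_rpow_of_nonneg _ _ hR0.le, ← ENNReal.rpow_mul,
          one_div_mul_cancel hR0.ne', ENNReal.rpow_one]
    _ ≤ (∫⁻ x, (K ^ (1 / r.toReal) * ∫⁻ y, F y * G (x - y)) ^ r.toReal) ^ (1 / r.toReal) := by
        refine ENNReal.rpow_le_rpow (lintegral_mono fun x => ?_) hR1
        exact ENNReal.rpow_le_rpow (absConv_mul_jweight_rpow_le ha hR0 x) hR0.le
    _ = K ^ (1 / r.toReal) *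
          (∫⁻ x, (∫⁻ y, F y * G (x - y)) ^ r.toReal) ^ (1 / r.toReal) := by
        simp_rw [ENNReal.mul_rpow_of_nonneg _ _ hR0.le, ← ENNReal.rpow_mul,
          one_div_mul_cancel hR0.ne', ENNReal.rpow_one]
        rw [lintegral_const_mul' _ _ ENNReal.ofReal_ne_top, ENNReal.mul_rpow_of_nonneg _ _ hR1]
    _ ≤ K ^ (1 / r.toReal) * ((∫⁻ y, F y ^ p.toReal) ^ (1 / p.toReal) *
          (∫⁻ y, G y ^ q.toReal) ^ (1 / q.toReal)) := by
        gcongr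
        exact lintegral_rpow_conv_le (one_le hp hp') (one_le hq hq') hR hpqr'
          (hf.enorm.mul hweight) (hg.enorm.mul hweight)
    _ ≤ youngConst a r * (wNorm p a f * wNorm q a g) := by
        rw [youngConst_eq_rpow]
        gcongr
        · exact lintegral_mul_jweight_rpow_le_wNormE ha hp' hR0 (ENNReal.toReal_mono hr' hpr) _
        · exact lintegral_mul_jweight_rpow_le_wNormE ha hq' hR0 (ENNReal.toReal_mono hr' hqr) _

theorem wNormE_absConv_le (ha : 0 ≤ a) (hp : 1 ≤ p) (hq : 1 ≤ q) (hr : 1 ≤ r)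
    (hpqr : 1 / r + 1 = 1 / p + 1 / q) (hf : AEMeasurable f volume) (hg : AEMeasurable g volume) :
    wNormE r a (absConv f g) ≤ youngConst a r * (wNorm p a f * wNorm q a g) := by
  rcases eq_or_ne r ∞ with rfl | hr'
  · rw [wNormE, if_pos rfl, youngConst_top, one_mul]
    exact essSup_le_of_ae_le _ (Filter.Eventually.of_forall
      (absConv_le_of_conjugate ha hp hq (by simpa using hpqr) hf hg))
  · exact wNormE_absConv_le_of_ne_top ha hp hq hr hr' hpqr hf hg

end Convolution

theorem weighted_young (n : ℕ) (hn : 1 ≤ n) (a : ℝ) (ha : 0 ≤ a) (p q r : ℝ≥0∞)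
    (hp : 1 ≤ p) (hq : 1 ≤ q) (hr : 1 ≤ r)
    (hpqr : 1 / r + 1 = 1 / p + 1 / q)
    (f g : Eu n → ℂ) (hf : AEMeasurable f volume) (hg : AEMeasurable g volume) :
    wNormE r a (absConv f g) ≤ youngConst a r * (wNorm p a f * wNorm q a g) ∧
    (wNorm p a f < ∞ → wNorm q a g < ∞ →
      (∀ᵐ x ∂(volume : Measure (Eu n)),
        ConvolutionExistsAt f g x (ContinuousLinearMap.mul ℂ ℂ) volume) ∧
      wNorm r a (convolution f g (ContinuousLinearMap.mul ℂ ℂ) volume) ≤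
        youngConst a r * (wNorm p a f * wNorm q a g)) := by
  have main := wNormE_absConv_le ha hp hq hr hpqr hf hg
  refine ⟨main, fun hfin hgin => ⟨?_, (wNormE_mono enorm_convolution_mul_le_absConv).trans main⟩⟩
  have hlt : wNormE r a (absConv f g) < ∞ :=
    main.trans_lt (ENNReal.mul_lt_top ENNReal.ofReal_lt_top (ENNReal.mul_lt_top hfin hgin))
  filter_upwards [ae_lt_top_of_wNormE_lt_top ha hr (aemeasurable_absConv hf hg) hlt] with x hx
  exact convolutionExistsAt_mul_of_absConv_lt_top hf hg hx
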